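/- For every L > 0 there exist gains k₁, k₂, k₃ > 0, k₄ ≥ 0 and observer gains l₁, l₂ > 0 such that the following holds: for every ρ : ℝ → ℝ that is Lipschitz with constant L, and for every Filippov solution (x₁, x₂, e₁, e₂, z) on [0,∞) of the output-feedback closed loop ẋ₁ = x₂, ẋ₂ = −k₁⌈x₁⌋^{1/3} − k₂⌈x₂ + e₂⌋^{1/2} + z + ρ(t), ė₁ = −l₁⌈e₁⌋^{2/3} + e₂, ė₂ = −l₂⌈e₁⌋^{1/3} − (z + ρ(t)), ż = −k₃⌈x₁ + k₄⌈x₂ + e₂⌋^{3/2}⌋⁰ — meaning x₁, x₂, e₁, e₂ are C¹, z is locally Lipschitz, the first four equations hold for all t ≥ 0, and for almost every t ≥ 0 one has ż(t) = −k₃·sign(x₁(t) + k₄⌈x₂(t) + e₂(t)⌋^{3/2}) whenever x₁(t) + k₄⌈x₂(t) + e₂(t)⌋^{3/2} ≠ 0 and |ż(t)| ≤ k₃ otherwise — there exists a time T ≥ 0 such that x₁(t) = 0, x₂(t) = 0, e₁(t) = 0, e₂(t) = 0 and z(t) + ρ(t) = 0 for all t ≥ T. -/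

import Mathlib

open MeasureTheory

/-- Signed power: `⌈z⌋^p = |z|^p · sign z` (for `p = 0` this is `sign z`). -/
noncomputable def spow (z p : ℝ) : ℝ := |z| ^ p * Real.sign z

lemma spow_of_nonneg {x p : ℝ} (hx : 0 ≤ x) (hp : 0 < p) : spow x p = x ^ p := by
  rcases hx.eq_or_lt with h | h
  · subst h; simp [spow, hp.ne']
  · simp [spow, Real.sign_of_pos h, abs_of_pos h]

lemma spow_neg (x p : ℝ) : spow (-x) p = - spow x p := by
  simp [spow, Real.sign_neg]

lemma spow_eq_max (x : ℝ) {p : ℝ} (hp : 0 < p) :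
    spow x p = (max x 0) ^ p - (max (-x) 0) ^ p := by
  rcases le_total 0 x with h | h
  · rw [spow_of_nonneg h hp, max_eq_left h, max_eq_right (by linarith), Real.zero_rpow hp.ne']
    ring
  · have := spow_neg (-x) p
    rw [neg_neg] at this
    rw [this, spow_of_nonneg (by linarith) hp, max_eq_right h, max_eq_left (by linarith),
      Real.zero_rpow hp.ne']
    ring

lemma continuous_spow {p : ℝ} (hp : 0 < p) : Continuous (fun x => spow x p) := by
  have : (fun x => spow x p) = fun x => (max x 0) ^ p - (max (-x) 0) ^ p := by
    funext x; exact spow_eq_max x hp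
  rw [this]
  refine Continuous.sub ?_ ?_
  · exact Continuous.rpow_const (by fun_prop) (fun _ => Or.inr hp.le)
  · exact Continuous.rpow_const (by fun_prop) (fun _ => Or.inr hp.le)

lemma spow_scale {r : ℝ} (hr : 0 < r) (x p : ℝ) : spow (r * x) p = r ^ p * spow x p := by
  have : Real.sign (r * x) = Real.sign x := by
    rcases lt_trichotomy x 0 with h | h | h
    · rw [Real.sign_of_neg h, Real.sign_of_neg (mul_neg_of_pos_of_neg hr h)]
    · simp [h]
    · rw [Real.sign_of_pos h, Real.sign_of_pos (mul_pos hr h)]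
  simp only [spow, this, abs_mul, abs_of_pos hr]
  rw [Real.mul_rpow hr.le (abs_nonneg x)]
  ring

lemma spow_third_cube (x : ℝ) : (spow x (1/3)) ^ 3 = x := by
  have key : ∀ x : ℝ, 0 ≤ x → (spow x (1/3)) ^ 3 = x := by
    intro x hx
    rw [spow_of_nonneg hx (by norm_num), ← Real.rpow_natCast, ← Real.rpow_mul hx]
    norm_num
  rcases le_total 0 x with h | h
  · exact key x h
  · have := key (-x) (by linarith)
    rw [spow_neg] at this
    linarith [this, Odd.neg_pow (show Odd 3 by decide) (spow x (1/3))]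

lemma spow_half_sq (x : ℝ) : spow x (1/2) * |spow x (1/2)| = x := by
  have key : ∀ x : ℝ, 0 ≤ x → spow x (1/2) * |spow x (1/2)| = x := by
    intro x hx
    rw [spow_of_nonneg hx (by norm_num), abs_of_nonneg (by positivity), ← sq,
      ← Real.rpow_natCast, ← Real.rpow_mul hx]
    norm_num
  rcases le_total 0 x with h | h
  · exact key x h
  · have := key (-x) (by linarith)
    rw [spow_neg, abs_neg] at this
    linarith

lemma spow_two_thirds (x : ℝ) : spow x (2/3) = spow x (1/3) * |spow x (1/3)| := by
  have key : ∀ x : ℝ, 0 ≤ x → spow x (2/3) = spow x (1/3) * |spow x (1/3)| := by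
    intro x hx
    rw [spow_of_nonneg hx (by norm_num), spow_of_nonneg hx (by norm_num),
      abs_of_nonneg (by positivity), ← sq, ← Real.rpow_natCast, ← Real.rpow_mul hx]
    norm_num
  rcases le_total 0 x with h | h
  · exact key x h
  · have := key (-x) (by linarith)
    rw [spow_neg, spow_neg, abs_neg] at this
    linarith

lemma abs_four_thirds (x : ℝ) : |x| ^ (4/3 : ℝ) = (spow x (1/3)) ^ 4 := by
  have key : ∀ x : ℝ, 0 ≤ x → |x| ^ (4/3 : ℝ) = (spow x (1/3)) ^ 4 := by
    intro x hx
    rw [spow_of_nonneg hx (by norm_num), abs_of_nonneg hx, ← Real.rpow_natCast, ← Real.rpow_mul hx]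
    norm_num
  rcases le_total 0 x with h | h
  · exact key x h
  · have := key (-x) (by linarith)
    rw [spow_neg, abs_neg] at this
    rw [this]; ring

lemma sq_sgn_mono {s t : ℝ} (h : s < t) : s * |s| < t * |t| := by
  rcases le_total 0 s with hs | hs
  · rw [abs_of_nonneg hs, abs_of_nonneg (by linarith)]; nlinarith
  · rcases le_total 0 t with ht | ht
    · rw [abs_of_nonpos hs, abs_of_nonneg ht]
      rcases hs.eq_or_lt with h0 | h0
      · subst h0; nlinarith
      · nlinarith
    · rw [abs_of_nonpos hs, abs_of_nonpos ht]; nlinarith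

lemma mono_prod (s w : ℝ) : 0 ≤ (s + w) * (s * |s| + w * |w|) ∧
    ((s + w) * (s * |s| + w * |w|) = 0 → s = -w) := by
  rcases lt_trichotomy s (-w) with h | h | h
  · have := sq_sgn_mono h
    rw [abs_neg] at this
    have h2 : 0 < (s + w) * (s * |s| + w * |w|) :=
      mul_pos_of_neg_of_neg (by linarith) (by linarith)
    exact ⟨h2.le, fun h3 => absurd h3 h2.ne'⟩
  · subst h; simp
  · have := sq_sgn_mono h
    rw [abs_neg] at this
    have h2 : 0 < (s + w) * (s * |s| + w * |w|) :=
      mul_pos (by linarith) (by linarith)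
    exact ⟨h2.le, fun h3 => absurd h3 h2.ne'⟩

lemma dominate {X : Type*} [TopologicalSpace X] {K : Set X} (hK : IsCompact K) {f g : X → ℝ}
    (hf : Continuous f) (hg : Continuous g) (hf0 : ∀ x ∈ K, f x ≤ 0)
    (h : ∀ x ∈ K, f x = 0 → g x < 0) :
    ∃ l₀ > (0 : ℝ), ∀ l ≥ l₀, ∀ x ∈ K, g x + l * f x < 0 := by
  have hK' : IsCompact (K ∩ {x | 0 ≤ g x}) :=
    hK.inter_right (isClosed_le continuous_const hg)
  rcases (K ∩ {x | 0 ≤ g x}).eq_empty_or_nonempty with he | hne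
  · refine ⟨1, one_pos, fun l hl x hx => ?_⟩
    have h1 : g x < 0 := by
      by_contra hc
      have : x ∈ K ∩ {x | 0 ≤ g x} := ⟨hx, not_lt.mp hc⟩
      rw [he] at this
      exact this
    nlinarith [hf0 x hx, mul_nonneg (show 0 ≤ l by linarith) (neg_nonneg.mpr (hf0 x hx))]
  · obtain ⟨x0, hx0, hmax⟩ := hK'.exists_isMaxOn hne hf.continuousOn
    obtain ⟨x1, hx1, hmax1⟩ := hK'.exists_isMaxOn hne hg.continuousOn
    have hneg : f x0 < 0 := by
      rcases (hf0 x0 hx0.1).eq_or_lt with h0 | h0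
      · exact absurd (h x0 hx0.1 h0) (not_lt.mpr hx0.2)
      · exact h0
    have hg1 : 0 ≤ g x1 := hx1.2
    refine ⟨(g x1 + 1) / (- f x0), by apply div_pos <;> linarith, fun l hl x hx => ?_⟩
    have hl0 : 0 < l := lt_of_lt_of_le (by apply div_pos <;> linarith) hl
    by_cases hgx : 0 ≤ g x
    · have a1 : f x ≤ f x0 := hmax ⟨hx, hgx⟩
      have a2 : g x ≤ g x1 := hmax1 ⟨hx, hgx⟩
      have a3 : g x1 + 1 ≤ l * (- f x0) := by
        rw [ge_iff_le, div_le_iff₀ (by linarith)] at hl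
        exact hl
      nlinarith [mul_le_mul_of_nonneg_left a1 hl0.le]
    · push Not at hgx
      nlinarith [mul_nonneg hl0.le (neg_nonneg.mpr (hf0 x hx))]

/-! ### Static functions, in coordinates `y = (a, b, p, q, w)` of weight one -/

noncomputable def sU (y : Fin 5 → ℝ) : ℝ :=
  3/4 * y 2 ^ 4 + y 4 * y 2 ^ 3 + y 4 ^ 4 / 4 + (y 3 * |y 3| + y 4 * |y 4|) ^ 2 / 2
noncomputable def sH (y : Fin 5 → ℝ) : ℝ :=
  3/4 * y 0 ^ 4 - 2 * y 4 * y 0 ^ 3 + 4 * y 4 ^ 4 + (y 1 * |y 1|) ^ 2 / 2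
noncomputable def sS (y : Fin 5 → ℝ) : ℝ := spow (y 1 * |y 1| + y 3 * |y 3|) (1/2)
noncomputable def sc1 (y : Fin 5 → ℝ) : ℝ := -((y 2 ^ 3 + y 4 ^ 3) * (y 3 * |y 3| + y 4 * |y 4|))
noncomputable def sc2 (y : Fin 5 → ℝ) : ℝ := (y 0 ^ 3 - 8 * y 4 ^ 3) * (y 1 * |y 1|)
noncomputable def sf1 (y : Fin 5 → ℝ) : ℝ :=
  -(5/4 * sU y ^ (1/4 : ℝ) * ((y 2 + y 4) * (y 2 * |y 2| + y 4 * |y 4|)))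
noncomputable def sf2 (y : Fin 5 → ℝ) : ℝ :=
  -((-(y 2 * |y 2|) + y 3 * |y 3|) * (y 3 * |y 3| + y 4 * |y 4|)
    + (y 2 ^ 3 + y 4 ^ 3) * (-y 2 - y 4))
noncomputable def sf3 (y : Fin 5 → ℝ) : ℝ :=
  -(5/4 * sH y ^ (1/4 : ℝ) * (y 1 * |y 1| * (sS y + y 4)))
noncomputable def sf4 (y : Fin 5 → ℝ) : ℝ :=
  (y 1 * |y 1|) ^ 2 + (y 0 ^ 3 - 8 * y 4 ^ 3) * (- y 0 - sS y + y 4)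
noncomputable def sfw (y : Fin 5 → ℝ) : ℝ :=
  -(5/2) * y 4 ^ 4 + 5/4 * (|y 4| * |y 0 ^ 3 - 8 * y 4 ^ 3|)
noncomputable def sh1 (y : Fin 5 → ℝ) : ℝ :=
  5/4 * sU y ^ (1/4 : ℝ) * (y 2 ^ 3 + y 4 ^ 3 + 2 * |y 4| * (y 3 * |y 3| + y 4 * |y 4|))
noncomputable def sh2 (y : Fin 5 → ℝ) : ℝ :=
  -(3 * y 4 ^ 2 * (y 3 * |y 3| + y 4 * |y 4|) + (y 2 ^ 3 + y 4 ^ 3) * (2 * |y 4|))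
noncomputable def sh3 (y : Fin 5 → ℝ) : ℝ :=
  5/4 * sH y ^ (1/4 : ℝ) * (-2 * y 0 ^ 3 + 16 * y 4 ^ 3)
noncomputable def sh4 (y : Fin 5 → ℝ) : ℝ := -24 * y 4 ^ 2 * (y 1 * |y 1|)

noncomputable def sV (A B C D μ : ℝ) (y : Fin 5 → ℝ) : ℝ :=
  A * sU y ^ (5/4 : ℝ) + B * sc1 y + C * sH y ^ (5/4 : ℝ) + D * sc2 y
    + μ * (y 4 ^ 3 * (y 4 * |y 4|))
noncomputable def sG (A B C D ε : ℝ) (y : Fin 5 → ℝ) : ℝ :=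
  A * sf1 y + B * sf2 y + C * sf3 y + D * sf4 y + sfw y
    + 3/2 * ε * |A * sh1 y + B * sh2 y + C * sh3 y + D * sh4 y|

lemma quart_nonneg (p w : ℝ) : 0 ≤ 3/4 * p ^ 4 + w * p ^ 3 + w ^ 4 / 4 ∧
    (3/4 * p ^ 4 + w * p ^ 3 + w ^ 4 / 4 = 0 → p = -w) := by
  have e : 3/4 * p ^ 4 + w * p ^ 3 + w ^ 4 / 4 = (p + w) ^ 2 * (2 * p ^ 2 + (p - w) ^ 2) / 4 := by
    ring
  rw [e]
  refine ⟨by positivity, fun h => ?_⟩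
  have h1 : (p + w) ^ 2 * (2 * p ^ 2 + (p - w) ^ 2) = 0 := by linarith
  rcases mul_eq_zero.mp h1 with h2 | h2
  · have := pow_eq_zero_iff (two_ne_zero) |>.mp h2
    linarith
  · have hp : p = 0 := by nlinarith [sq_nonneg p, sq_nonneg (p - w)]
    have hw : (p - w) ^ 2 = 0 := by nlinarith [sq_nonneg p, sq_nonneg (p - w)]
    have := pow_eq_zero_iff (two_ne_zero) |>.mp hw
    linarith

lemma sgnsq_eq_zero {x : ℝ} (h : x * |x| = 0) : x = 0 := by
  rcases mul_eq_zero.mp h with h | h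
  · exact h
  · exact abs_eq_zero.mp h

lemma sgnsq_add_zero {q w : ℝ} (h : q * |q| + w * |w| = 0) : q = -w := by
  have := (mono_prod q w).2
  rw [h] at this
  exact this (by ring)

lemma sU_nonneg (y) : 0 ≤ sU y := by
  have := (quart_nonneg (y 2) (y 4)).1
  unfold sU; positivity
lemma sU_zero {y} (h : sU y = 0) : y 2 = - y 4 ∧ y 3 = - y 4 := by
  have h1 := (quart_nonneg (y 2) (y 4))
  unfold sU at h
  have h2 := sq_nonneg (y 3 * |y 3| + y 4 * |y 4|)
  refine ⟨h1.2 (by linarith [h1.1]), sgnsq_add_zero ?_⟩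
  exact pow_eq_zero_iff (two_ne_zero) |>.mp (by linarith [h1.1])
lemma sH_eq (y) : sH y = 3/4 * y 0 ^ 4 + (-2 * y 4) * y 0 ^ 3 + (-2 * y 4) ^ 4 / 4
    + (y 1 * |y 1|) ^ 2 / 2 := by
  unfold sH; ring
lemma sH_nonneg (y) : 0 ≤ sH y := by
  have := (quart_nonneg (y 0) (-2 * y 4)).1
  rw [sH_eq]; positivity
lemma sH_zero {y} (h : sH y = 0) : y 0 = 2 * y 4 ∧ y 1 = 0 := by
  have h1 := (quart_nonneg (y 0) (-2 * y 4))
  rw [sH_eq] at h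
  have h2 := sq_nonneg (y 1 * |y 1|)
  refine ⟨by linarith [h1.2 (by linarith [h1.1])], sgnsq_eq_zero ?_⟩
  exact pow_eq_zero_iff (two_ne_zero) |>.mp (by linarith [h1.1])

lemma cU : Continuous sU := by unfold sU; fun_prop
lemma cH : Continuous sH := by unfold sH; fun_prop
lemma cS : Continuous sS := by
  unfold sS
  exact (continuous_spow (by norm_num)).comp (by fun_prop)
lemma cUp {p : ℝ} (hp : 0 ≤ p) : Continuous (fun y => sU y ^ p) :=
  cU.rpow_const (fun _ => Or.inr hp)
lemma cHp {p : ℝ} (hp : 0 ≤ p) : Continuous (fun y => sH y ^ p) :=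
  cH.rpow_const (fun _ => Or.inr hp)
lemma cc1 : Continuous sc1 := by unfold sc1; fun_prop
lemma cc2 : Continuous sc2 := by unfold sc2; fun_prop
lemma cf1 : Continuous sf1 := by
  have := cUp (p := 1/4) (by norm_num)
  unfold sf1; fun_prop
lemma cf2 : Continuous sf2 := by unfold sf2; fun_prop
lemma cf3 : Continuous sf3 := by
  have := cHp (p := 1/4) (by norm_num)
  have := cS
  unfold sf3; fun_prop
lemma cf4 : Continuous sf4 := by
  have := cS
  unfold sf4; fun_prop
lemma cfw : Continuous sfw := by unfold sfw; fun_prop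
lemma ch1 : Continuous sh1 := by
  have := cUp (p := 1/4) (by norm_num)
  unfold sh1; fun_prop
lemma ch2 : Continuous sh2 := by unfold sh2; fun_prop
lemma ch3 : Continuous sh3 := by
  have := cHp (p := 1/4) (by norm_num)
  unfold sh3; fun_prop
lemma ch4 : Continuous sh4 := by unfold sh4; fun_prop
lemma cV (A B C D μ : ℝ) : Continuous (sV A B C D μ) := by
  have := cUp (p := 5/4) (by norm_num)
  have := cHp (p := 5/4) (by norm_num)
  have := cc1
  have := cc2
  unfold sV; fun_prop
lemma cG (A B C D ε : ℝ) : Continuous (sG A B C D ε) := by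
  have := cf1
  have := cf2
  have := cf3
  have := cf4
  have := cfw
  have := ch1
  have := ch2
  have := ch3
  have := ch4
  unfold sG; fun_prop

lemma smulU {r : ℝ} (hr : 0 < r) (y) : sU (r • y) = r ^ 4 * sU y := by
  simp only [sU, Pi.smul_apply, smul_eq_mul, abs_mul, abs_of_pos hr]; ring
lemma smulH {r : ℝ} (hr : 0 < r) (y) : sH (r • y) = r ^ 4 * sH y := by
  simp only [sH, Pi.smul_apply, smul_eq_mul, abs_mul, abs_of_pos hr]; ring
lemma smulS {r : ℝ} (hr : 0 < r) (y) : sS (r • y) = r * sS y := by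
  simp only [sS, Pi.smul_apply, smul_eq_mul, abs_mul, abs_of_pos hr]
  have : r * y 1 * (r * |y 1|) + r * y 3 * (r * |y 3|)
    = r ^ 2 * (y 1 * |y 1| + y 3 * |y 3|) := by ring
  rw [this, spow_scale (by positivity), ← Real.rpow_natCast, ← Real.rpow_mul hr.le]
  norm_num
lemma pow4_quarter {r : ℝ} (hr : 0 < r) : (r ^ 4) ^ (1/4 : ℝ) = r := by
  rw [← Real.rpow_natCast, ← Real.rpow_mul hr.le]; norm_num
lemma pow4_five_quarter {r : ℝ} (hr : 0 < r) : (r ^ 4) ^ (5/4 : ℝ) = r ^ 5 := by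
  rw [← Real.rpow_natCast, ← Real.rpow_natCast, ← Real.rpow_mul hr.le]; norm_num

lemma smulV (A B C D μ : ℝ) {r : ℝ} (hr : 0 < r) (y) :
    sV A B C D μ (r • y) = r ^ 5 * sV A B C D μ y := by
  unfold sV
  rw [smulU hr, smulH hr, Real.mul_rpow (by positivity) (sU_nonneg y),
    Real.mul_rpow (by positivity) (sH_nonneg y), pow4_five_quarter hr]
  simp only [sc1, sc2, Pi.smul_apply, smul_eq_mul, abs_mul, abs_of_pos hr]
  ring

lemma smulG (A B C D ε : ℝ) {r : ℝ} (hr : 0 < r) (y) :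
    sG A B C D ε (r • y) = r ^ 4 * sG A B C D ε y := by
  have e1 : sf1 (r • y) = r ^ 4 * sf1 y := by
    unfold sf1
    rw [smulU hr, Real.mul_rpow (by positivity) (sU_nonneg y), pow4_quarter hr]
    simp only [Pi.smul_apply, smul_eq_mul, abs_mul, abs_of_pos hr]
    ring
  have e2 : sf2 (r • y) = r ^ 4 * sf2 y := by
    simp only [sf2, Pi.smul_apply, smul_eq_mul, abs_mul, abs_of_pos hr]
    ring
  have e3 : sf3 (r • y) = r ^ 4 * sf3 y := by
    unfold sf3
    rw [smulH hr, smulS hr, Real.mul_rpow (by positivity) (sH_nonneg y), pow4_quarter hr]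
    simp only [Pi.smul_apply, smul_eq_mul, abs_mul, abs_of_pos hr]
    ring
  have e4 : sf4 (r • y) = r ^ 4 * sf4 y := by
    unfold sf4
    rw [smulS hr]
    simp only [Pi.smul_apply, smul_eq_mul, abs_mul, abs_of_pos hr]
    ring
  have ew : sfw (r • y) = r ^ 4 * sfw y := by
    simp only [sfw, Pi.smul_apply, smul_eq_mul]
    have : (r * y 0) ^ 3 - 8 * (r * y 4) ^ 3 = r ^ 3 * (y 0 ^ 3 - 8 * y 4 ^ 3) := by ring
    rw [this, abs_mul, abs_mul, abs_of_pos hr, abs_of_pos (pow_pos hr 3)]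
    ring
  have g1 : sh1 (r • y) = r ^ 4 * sh1 y := by
    unfold sh1
    rw [smulU hr, Real.mul_rpow (by positivity) (sU_nonneg y), pow4_quarter hr]
    simp only [Pi.smul_apply, smul_eq_mul, abs_mul, abs_of_pos hr]
    ring
  have g2 : sh2 (r • y) = r ^ 4 * sh2 y := by
    simp only [sh2, Pi.smul_apply, smul_eq_mul, abs_mul, abs_of_pos hr]
    ring
  have g3 : sh3 (r • y) = r ^ 4 * sh3 y := by
    unfold sh3
    rw [smulH hr, Real.mul_rpow (by positivity) (sH_nonneg y), pow4_quarter hr]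
    simp only [Pi.smul_apply, smul_eq_mul]
    ring
  have g4 : sh4 (r • y) = r ^ 4 * sh4 y := by
    simp only [sh4, Pi.smul_apply, smul_eq_mul, abs_mul, abs_of_pos hr]
    ring
  unfold sG
  rw [e1, e2, e3, e4, ew, g1, g2, g3, g4]
  have : A * (r ^ 4 * sh1 y) + B * (r ^ 4 * sh2 y) + C * (r ^ 4 * sh3 y) + D * (r ^ 4 * sh4 y)
    = r ^ 4 * (A * sh1 y + B * sh2 y + C * sh3 y + D * sh4 y) := by ring
  rw [this, abs_mul, abs_of_pos (pow_pos hr 4)]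
  ring


lemma sS_id (y : Fin 5 → ℝ) : sS y * |sS y| = y 1 * |y 1| + y 3 * |y 3| := spow_half_sq _

lemma ne_zero_of_sphere {y : Fin 5 → ℝ} (hy : y ∈ Metric.sphere (0 : Fin 5 → ℝ) 1)
    (h0 : y 0 = 0) (h1 : y 1 = 0) (h2 : y 2 = 0) (h3 : y 3 = 0) (h4 : y 4 = 0) : False := by
  have : y = 0 := by
    funext i
    fin_cases i <;> simp [h0, h1, h2, h3, h4]
  subst this
  simp at hy

lemma sf1_nonpos (y) : sf1 y ≤ 0 := by
  have h1 := (mono_prod (y 2) (y 4)).1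
  have h2 := Real.rpow_nonneg (sU_nonneg y) (1/4)
  unfold sf1
  have : 0 ≤ 5/4 * sU y ^ (1/4 : ℝ) * ((y 2 + y 4) * (y 2 * |y 2| + y 4 * |y 4|)) := by positivity
  linarith

lemma sf1_zero {y} (h : sf1 y = 0) : y 2 = - y 4 := by
  unfold sf1 at h
  have h' : 5/4 * sU y ^ (1/4 : ℝ) * ((y 2 + y 4) * (y 2 * |y 2| + y 4 * |y 4|)) = 0 := by linarith
  rcases mul_eq_zero.mp h' with h1 | h1
  · have h2 : sU y ^ (1/4 : ℝ) = 0 := by linarith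
    rw [Real.rpow_eq_zero (sU_nonneg y) (by norm_num)] at h2
    exact (sU_zero h2).1
  · exact (mono_prod (y 2) (y 4)).2 h1

lemma sf2_on {y : Fin 5 → ℝ} (h : y 2 = - y 4) : sf2 y = -(y 3 * |y 3| + y 4 * |y 4|) ^ 2 := by
  unfold sf2
  rw [h, abs_neg]
  ring

lemma sf3_on {y : Fin 5 → ℝ} (h : y 3 = - y 4) : sf3 y ≤ 0 ∧ (sf3 y = 0 → y 1 = 0) := by
  have hs := sS_id y
  rw [h, abs_neg] at hs
  have hs' : y 1 * |y 1| = sS y * |sS y| + y 4 * |y 4| := by linarith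
  have hm := mono_prod (sS y) (y 4)
  have h2 := Real.rpow_nonneg (sH_nonneg y) (1/4)
  have e : sf3 y = -(5/4 * sH y ^ (1/4 : ℝ) * ((sS y + y 4) * (sS y * |sS y| + y 4 * |y 4|))) := by
    unfold sf3; rw [hs']; ring
  rw [e]
  have hm1 := hm.1
  refine ⟨?_, fun h0 => ?_⟩
  · have : 0 ≤ (5/4 * sH y ^ (1/4 : ℝ) * ((sS y + y 4) * (sS y * |sS y| + y 4 * |y 4|))) := by
      positivity
    linarith
  · rcases mul_eq_zero.mp (neg_eq_zero.mp h0) with h1 | h1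
    · have h2 : sH y ^ (1/4 : ℝ) = 0 := by linarith
      rw [Real.rpow_eq_zero (sH_nonneg y) (by norm_num)] at h2
      exact (sH_zero h2).2
    · have := hm.2 h1
      rw [this, abs_neg] at hs'
      exact sgnsq_eq_zero (by linarith)

lemma sf4_on {y : Fin 5 → ℝ} (h : y 3 = - y 4) (h1 : y 1 = 0) :
    sf4 y ≤ 0 ∧ (sf4 y = 0 → y 0 = 2 * y 4) := by
  have hs := sS_id y
  rw [h, h1, abs_neg] at hs
  have hs' : sS y = - y 4 := sgnsq_add_zero (by linarith)
  have e : sf4 y = -((y 0 - 2 * y 4) ^ 2 * ((y 0 + y 4) ^ 2 + 3 * y 4 ^ 2)) := by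
    unfold sf4; rw [hs', h1]; ring
  rw [e]
  refine ⟨?_, fun h0 => ?_⟩
  · have : 0 ≤ ((y 0 - 2 * y 4) ^ 2 * ((y 0 + y 4) ^ 2 + 3 * y 4 ^ 2)) := by positivity
    linarith
  · rcases mul_eq_zero.mp (neg_eq_zero.mp h0) with h1 | h1
    · have := pow_eq_zero_iff (two_ne_zero) |>.mp h1
      linarith
    · have a1 : (y 0 + y 4) ^ 2 = 0 := by nlinarith [sq_nonneg (y 0 + y 4), sq_nonneg (y 4)]
      have a2 : y 4 ^ 2 = 0 := by nlinarith [sq_nonneg (y 0 + y 4), sq_nonneg (y 4)]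
      have := pow_eq_zero_iff (two_ne_zero) |>.mp a1
      have := pow_eq_zero_iff (two_ne_zero) |>.mp a2
      linarith

lemma static_sphere : ∃ A B C D ε : ℝ, 0 < ε ∧
    ∀ y ∈ Metric.sphere (0 : Fin 5 → ℝ) 1, 0 < sV A B C D (1/ε) y ∧ sG A B C D ε y < 0 := by
  set K := Metric.sphere (0 : Fin 5 → ℝ) 1 with hKdef
  have hK : IsCompact K := isCompact_sphere _ _
  have hU := cUp (p := 5/4) (by norm_num)
  have hH := cHp (p := 5/4) (by norm_num)
  have := cc1
  have := cc2
  have := cf1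
  have := cf2
  have := cf3
  have := cf4
  have := cfw
  have := ch1
  have := ch2
  have := ch3
  have := ch4
  -- closed subsets
  have k1 : IsCompact (K ∩ {y | y 2 = - y 4}) :=
    hK.inter_right (isClosed_eq (by fun_prop) (by fun_prop))
  have k2 : IsCompact (K ∩ {y | y 2 = - y 4} ∩ {y | y 3 = - y 4}) :=
    k1.inter_right (isClosed_eq (by fun_prop) (by fun_prop))
  have k3 : IsCompact (K ∩ {y | y 2 = - y 4} ∩ {y | y 3 = - y 4} ∩ {y | y 1 = 0}) :=
    k2.inter_right (isClosed_eq (by fun_prop) (by fun_prop))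
  have kw : IsCompact (K ∩ {y | y 4 = 0}) :=
    hK.inter_right (isClosed_eq (by fun_prop) (by fun_prop))
  have kw2 : IsCompact (K ∩ {y | y 4 = 0} ∩ {y | y 2 = 0} ∩ {y | y 3 = 0}) :=
    (kw.inter_right (isClosed_eq (by fun_prop) (by fun_prop))).inter_right
      (isClosed_eq (by fun_prop) (by fun_prop))
  obtain ⟨D, hD, hD1⟩ := dominate k3 (f := sf4) (g := sfw) cf4 cfw
    (fun y hy => (sf4_on hy.1.2 hy.2).1) (by
      rintro y ⟨⟨⟨hy, h2⟩, h3⟩, h1⟩ h0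
      have ha := (sf4_on h3 h1).2 h0
      simp only [Set.mem_ofPred_eq] at h1 h2 h3
      have e : sfw y = -(5/2) * y 4 ^ 4 := by
        unfold sfw
        rw [ha, show (2 * y 4) ^ 3 - 8 * y 4 ^ 3 = 0 by ring]; simp
      have hw : y 4 ≠ 0 := by
        intro hw
        rw [hw] at h2 h3 ha
        exact ne_zero_of_sphere hy (by linarith) h1 (by linarith) (by linarith) hw
      rw [e]
      have : 0 < y 4 ^ 4 := by positivity
      linarith)
  have hD1 := hD1 D le_rfl
  obtain ⟨C1, hC1, hC1'⟩ := dominate k2 (f := sf3) (g := fun y => sfw y + D * sf4 y) cf3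
    (by fun_prop) (fun y hy => (sf3_on hy.2).1)
    (fun y hy h0 => hD1 y ⟨hy, (sf3_on hy.2).2 h0⟩)
  obtain ⟨C2, hC2, hC2'⟩ := dominate kw2 (f := fun y => -(sH y ^ (5/4 : ℝ)))
    (g := fun y => -(D * sc2 y)) (by fun_prop) (by fun_prop)
    (fun y hy => by have := Real.rpow_nonneg (sH_nonneg y) (5/4); linarith) (by
      rintro y ⟨⟨⟨hy, h4⟩, h2⟩, h3⟩ h0
      exfalso
      simp only [Set.mem_ofPred_eq] at h4 h2 h3
      rw [neg_eq_zero, Real.rpow_eq_zero (sH_nonneg y) (by norm_num)] at h0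
      have := sH_zero h0
      exact ne_zero_of_sphere hy (by rw [this.1, h4]; ring) this.2 h2 h3 h4)
  set C := max C1 C2
  have hC1' := hC1' C (le_max_left _ _)
  have hC2' := hC2' C (le_max_right _ _)
  obtain ⟨B, hB, hB'⟩ := dominate k1 (f := sf2) (g := fun y => sfw y + D * sf4 y + C * sf3 y) cf2
    (by fun_prop) (fun y hy => by rw [sf2_on hy.2]; nlinarith [sq_nonneg (y 3 * |y 3| + y 4 * |y 4|)])
    (fun y hy h0 => by
      rw [sf2_on hy.2] at h0
      exact hC1' y ⟨hy, sgnsq_add_zero (pow_eq_zero_iff (two_ne_zero) |>.mp (neg_eq_zero.mp h0))⟩)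
  have hB' := hB' B le_rfl
  obtain ⟨A1, hA1, hA1'⟩ := dominate hK (f := sf1)
    (g := fun y => sfw y + D * sf4 y + C * sf3 y + B * sf2 y) cf1
    (by fun_prop) (fun y hy => sf1_nonpos y)
    (fun y hy h0 => hB' y ⟨hy, sf1_zero h0⟩)
  obtain ⟨A2, hA2, hA2'⟩ := dominate kw (f := fun y => -(sU y ^ (5/4 : ℝ)))
    (g := fun y => -(D * sc2 y) + C * (-(sH y ^ (5/4 : ℝ))) - B * sc1 y) (by fun_prop) (by fun_prop)
    (fun y hy => by have := Real.rpow_nonneg (sU_nonneg y) (5/4); linarith) (by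
      rintro y ⟨hy, h4⟩ h0
      simp only [Set.mem_ofPred_eq] at h4
      rw [neg_eq_zero, Real.rpow_eq_zero (sU_nonneg y) (by norm_num)] at h0
      have h := sU_zero h0
      rw [h4, neg_zero] at h
      have h5 := hC2' y ⟨⟨⟨hy, h4⟩, h.1⟩, h.2⟩
      have h6 : sc1 y = 0 := by unfold sc1; rw [h.1, h4]; ring
      rw [h6]; linarith)
  set A := max A1 A2
  have hA1' := hA1' A (le_max_left _ _)
  have hA2' := hA2' A (le_max_right _ _)
  obtain ⟨m1, hm1, hm1'⟩ := dominate hK (f := fun y => -(y 4 ^ 3 * (y 4 * |y 4|)))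
    (g := fun y => -(D * sc2 y) + C * (-(sH y ^ (5/4 : ℝ))) - B * sc1 y + A * (-(sU y ^ (5/4 : ℝ))))
    (by fun_prop) (by fun_prop)
    (fun y hy => by
      have : y 4 ^ 3 * (y 4 * |y 4|) = y 4 ^ 4 * |y 4| := by ring
      rw [this, neg_nonpos]; positivity)
    (fun y hy h0 => by
      have : y 4 ^ 3 * (y 4 * |y 4|) = y 4 ^ 4 * |y 4| := by ring
      rw [this, neg_eq_zero] at h0
      have h4 : y 4 = 0 := by simpa using h0
      exact hA2' y ⟨hy, h4⟩)
  obtain ⟨m2, hm2, hm2'⟩ := dominate hK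
    (f := fun y => sfw y + D * sf4 y + C * sf3 y + B * sf2 y + A * sf1 y)
    (g := fun y => 3/2 * |A * sh1 y + B * sh2 y + C * sh3 y + D * sh4 y|)
    (by fun_prop) (by fun_prop)
    (fun y hy => (hA1' y hy).le)
    (fun y hy h0 => absurd h0 (hA1' y hy).ne)
  set m := max m1 m2
  have hm : 0 < m := lt_max_of_lt_left hm1
  have hm1' := hm1' m (le_max_left _ _)
  have hm2' := hm2' m (le_max_right _ _)
  refine ⟨A, B, C, D, 1/m, by positivity, fun y hy => ⟨?_, ?_⟩⟩
  · have := hm1' y hy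
    unfold sV
    rw [one_div_one_div]
    linarith
  · have h := hm2' y hy
    unfold sG
    have h2 : (1/m) * (3/2 * |A * sh1 y + B * sh2 y + C * sh3 y + D * sh4 y| +
      m * (sfw y + D * sf4 y + C * sf3 y + B * sf2 y + A * sf1 y)) < 0 :=
      mul_neg_of_pos_of_neg (by positivity) h
    have h3 : (1/m) * (3/2 * |A * sh1 y + B * sh2 y + C * sh3 y + D * sh4 y| +
      m * (sfw y + D * sf4 y + C * sf3 y + B * sf2 y + A * sf1 y)) =
      A * sf1 y + B * sf2 y + C * sf3 y + D * sf4 y + sfw y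
      + 3/2 * (1/m) * |A * sh1 y + B * sh2 y + C * sh3 y + D * sh4 y| := by
      field_simp; ring
    linarith

lemma static_main : ∃ A B C D ε c : ℝ, 0 < ε ∧ 0 < c ∧
    (∀ y, y ≠ 0 → 0 < sV A B C D (1/ε) y) ∧
    (∀ y, 0 ≤ sV A B C D (1/ε) y) ∧
    (∀ y, sG A B C D ε y ≤ -c * (sV A B C D (1/ε) y) ^ (4/5 : ℝ)) := by
  obtain ⟨A, B, C, D, ε, hε, h⟩ := static_sphere
  have hK : IsCompact (Metric.sphere (0 : Fin 5 → ℝ) 1) := isCompact_sphere _ _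
  have hne : (Metric.sphere (0 : Fin 5 → ℝ) 1).Nonempty :=
    NormedSpace.sphere_nonempty.mpr zero_le_one
  obtain ⟨yM, hyM, hM⟩ := hK.exists_isMaxOn hne (cV A B C D (1/ε)).continuousOn
  obtain ⟨yG, hyG, hG⟩ := hK.exists_isMaxOn hne (cG A B C D ε).continuousOn
  set M := sV A B C D (1/ε) yM with hMdef
  set g := sG A B C D ε yG with hgdef
  have hMpos : 0 < M := (h yM hyM).1
  have hgneg : g < 0 := (h yG hyG).2
  have hproj : ∀ y : Fin 5 → ℝ, y ≠ 0 → ∃ r > (0:ℝ), ∃ u ∈ Metric.sphere (0 : Fin 5 → ℝ) 1,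
      y = r • u := by
    intro y hy
    have hn : 0 < ‖y‖ := norm_pos_iff.mpr hy
    refine ⟨‖y‖, hn, ‖y‖⁻¹ • y, ?_, ?_⟩
    · rw [mem_sphere_zero_iff_norm, norm_smul, norm_inv, norm_norm, inv_mul_cancel₀ hn.ne']
    · rw [smul_smul, mul_inv_cancel₀ hn.ne', one_smul]
  have hU0 : sU 0 = 0 := by simp [sU]
  have hH0 : sH 0 = 0 := by simp [sH]
  have hV0 : sV A B C D (1/ε) 0 = 0 := by
    simp [sV, hU0, hH0, sc1, sc2]
  have hG0 : sG A B C D ε 0 = 0 := by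
    simp [sG, sf1, sf2, sf3, sf4, sfw, sh1, sh2, sh3, sh4, hU0, hH0]
  have hpos : ∀ y, y ≠ 0 → 0 < sV A B C D (1/ε) y := by
    intro y hy
    obtain ⟨r, hr, u, hu, rfl⟩ := hproj y hy
    rw [smulV _ _ _ _ _ hr]
    exact mul_pos (by positivity) (h u hu).1
  refine ⟨A, B, C, D, ε, -g / M ^ (4/5 : ℝ), hε, div_pos (by linarith) (by positivity), hpos, ?_, ?_⟩
  · intro y
    by_cases hy : y = 0
    · rw [hy, hV0]
    · exact (hpos y hy).le
  · intro y
    by_cases hy : y = 0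
    · rw [hy, hV0, hG0, Real.zero_rpow (by norm_num)]; simp
    obtain ⟨r, hr, u, hu, rfl⟩ := hproj y hy
    rw [smulV _ _ _ _ _ hr, smulG _ _ _ _ _ hr, Real.mul_rpow (by positivity) (h u hu).1.le]
    have e : (r ^ 5) ^ (4/5 : ℝ) = r ^ 4 := by
      rw [← Real.rpow_natCast, ← Real.rpow_natCast, ← Real.rpow_mul hr.le]; norm_num
    rw [e]
    have h1 : sG A B C D ε u ≤ g := hG hu
    have h2 : sV A B C D (1/ε) u ≤ M := hM hu
    have h3 : (sV A B C D (1/ε) u) ^ (4/5 : ℝ) ≤ M ^ (4/5 : ℝ) :=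
      Real.rpow_le_rpow (h u hu).1.le h2 (by norm_num)
    have h4 : (sV A B C D (1/ε) u) ^ (4/5 : ℝ) / M ^ (4/5 : ℝ) ≤ 1 :=
      (div_le_one (by positivity)).mpr h3
    have h5 : -(-g / M ^ (4/5 : ℝ)) * (r ^ 4 * (sV A B C D (1/ε) u) ^ (4/5 : ℝ))
      = r ^ 4 * (g * ((sV A B C D (1/ε) u) ^ (4/5 : ℝ) / M ^ (4/5 : ℝ))) := by ring
    rw [h5]
    apply mul_le_mul_of_nonneg_left _ (by positivity)
    nlinarith


lemma ac_comp {f g : ℝ → ℝ} {a b : ℝ} {S : Set ℝ} {K : NNReal}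
    (hf : AbsolutelyContinuousOnInterval f a b) (hg : LipschitzOnWith K g S)
    (hS : ∀ x ∈ Set.uIcc a b, f x ∈ S) : AbsolutelyContinuousOnInterval (fun x => g (f x)) a b := by
  rw [absolutelyContinuousOnInterval_iff] at hf ⊢
  intro ε hε
  obtain ⟨δ, hδ, h⟩ := hf (ε / (K + 1)) (by positivity)
  refine ⟨δ, hδ, fun E hE hE2 => ?_⟩
  have h1 := h E hE hE2
  calc ∑ i ∈ Finset.range E.1, dist (g (f (E.2 i).1)) (g (f (E.2 i).2))
      ≤ ∑ i ∈ Finset.range E.1, K * dist (f (E.2 i).1) (f (E.2 i).2) := by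
        apply Finset.sum_le_sum
        intro i hi
        exact hg.dist_le_mul _ (hS _ (hE.left i hi).left) _ (hS _ (hE.left i hi).right)
    _ = K * ∑ i ∈ Finset.range E.1, dist (f (E.2 i).1) (f (E.2 i).2) := by rw [Finset.mul_sum]
    _ ≤ K * (ε / (K + 1)) := by gcongr
    _ < (K + 1) * (ε / (K + 1)) := by gcongr; linarith
    _ = ε := by field

lemma ac_comp_ll {f g : ℝ → ℝ} {a b : ℝ} {S : Set ℝ}
    (hf : AbsolutelyContinuousOnInterval f a b) (hg : LocallyLipschitzOn S g)
    (hS : ∀ x ∈ Set.uIcc a b, f x ∈ S) : AbsolutelyContinuousOnInterval (fun x => g (f x)) a b := by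
  have hc : IsCompact (f '' Set.uIcc a b) := isCompact_uIcc.image_of_continuousOn hf.continuousOn
  have hsub : f '' Set.uIcc a b ⊆ S := by rintro _ ⟨x, hx, rfl⟩; exact hS x hx
  obtain ⟨K, hK⟩ := (hg.mono hsub).exists_lipschitzOnWith_of_compact hc
  exact ac_comp hf hK (fun x hx => ⟨x, hx, rfl⟩)

lemma ac_add {f g : ℝ → ℝ} {a b : ℝ} (hf : AbsolutelyContinuousOnInterval f a b)
    (hg : AbsolutelyContinuousOnInterval g a b) :
    AbsolutelyContinuousOnInterval (fun x => f x + g x) a b := hf.add hg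
lemma ac_sub {f g : ℝ → ℝ} {a b : ℝ} (hf : AbsolutelyContinuousOnInterval f a b)
    (hg : AbsolutelyContinuousOnInterval g a b) :
    AbsolutelyContinuousOnInterval (fun x => f x - g x) a b := hf.sub hg
lemma ac_mul {f g : ℝ → ℝ} {a b : ℝ} (hf : AbsolutelyContinuousOnInterval f a b)
    (hg : AbsolutelyContinuousOnInterval g a b) :
    AbsolutelyContinuousOnInterval (fun x => f x * g x) a b := hf.mul hg
lemma ac_cmul {f : ℝ → ℝ} {a b : ℝ} (c : ℝ) (hf : AbsolutelyContinuousOnInterval f a b) :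
    AbsolutelyContinuousOnInterval (fun x => c * f x) a b := hf.const_mul c
lemma ac_abs {f : ℝ → ℝ} {a b : ℝ} (hf : AbsolutelyContinuousOnInterval f a b) :
    AbsolutelyContinuousOnInterval (fun x => |f x|) a b :=
  ac_comp (K := 1) (S := Set.univ) (g := fun x => |x|) hf
    (lipschitzWith_one_norm.lipschitzOnWith) (fun _ _ => Set.mem_univ _)
lemma ac_rpow {f : ℝ → ℝ} {a b : ℝ} {p : ℝ} (hp : 1 ≤ p)
    (hf : AbsolutelyContinuousOnInterval f a b) :
    AbsolutelyContinuousOnInterval (fun x => f x ^ p) a b := by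
  have h : ContDiff ℝ 1 (fun x : ℝ => x ^ p) := by
    have := Real.contDiff_rpow_const_of_le (p := p) (n := 1) (by simpa using hp)
    simpa using this
  exact ac_comp_ll (S := Set.univ) (g := fun x => x ^ p) hf
    (h.locallyLipschitz.locallyLipschitzOn) (fun _ _ => Set.mem_univ _)

lemma ac_of_deriv {f f' : ℝ → ℝ} (hf : ∀ t ≥ (0:ℝ), HasDerivAt f (f' t) t)
    (hc : ContinuousOn f' (Set.Ici 0)) {T : ℝ} (hT : 0 ≤ T) :
    AbsolutelyContinuousOnInterval f 0 T := by
  have hsub : Set.Icc 0 T ⊆ Set.Ici (0:ℝ) := fun x hx => hx.1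
  obtain ⟨M, hM⟩ := isCompact_Icc.exists_bound_of_continuousOn (hc.mono hsub)
  have hM0 : 0 ≤ M := (norm_nonneg _).trans (hM 0 ⟨le_rfl, hT⟩)
  have := (convex_Icc 0 T).lipschitzOnWith_of_nnnorm_hasDerivWithin_le (f := f) (f' := f')
    (C := M.toNNReal) (fun x hx => (hf x hx.1).hasDerivWithinAt)
    (fun x hx => by
      rw [← NNReal.coe_le_coe, Real.coe_toNNReal _ hM0]; exact hM x hx)
  rw [← Set.uIcc_of_le hT] at this
  exact this.absolutelyContinuousOnInterval

lemma ac_decr {f : ℝ → ℝ} {a b c : ℝ} (ha : 0 ≤ a) (hab : a ≤ b)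
    (hf : AbsolutelyContinuousOnInterval f a b)
    (h : ∀ᵐ t ∂(volume.restrict (Set.Ici (0:ℝ))), t ∈ Set.Icc a b → ∃ v, HasDerivAt f v t ∧ v ≤ c) :
    f b - f a ≤ c * (b - a) := by
  rw [← hf.integral_deriv_eq_sub]
  have h1 : ∫ x in a..b, deriv f x ≤ ∫ x in a..b, c := by
    apply intervalIntegral.integral_mono_ae_restrict hab hf.intervalIntegrable_deriv
      intervalIntegrable_const
    have hsub : Set.Icc a b ⊆ Set.Ici (0:ℝ) := fun x hx => ha.trans hx.1
    have h2 := ae_restrict_of_ae_restrict_of_subset hsub h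
    filter_upwards [h2, ae_restrict_mem measurableSet_Icc] with t ht hm
    obtain ⟨v, hv, hvc⟩ := ht hm
    rw [hv.deriv]; exact hvc
  rw [intervalIntegral.integral_const, smul_eq_mul] at h1
  linarith

lemma finite_time {V : ℝ → ℝ} {c : ℝ} (hc : 0 < c) (hV : ∀ t, 0 ≤ V t)
    (hac : ∀ T, 0 ≤ T → AbsolutelyContinuousOnInterval V 0 T)
    (h : ∀ᵐ t ∂(volume.restrict (Set.Ici (0:ℝ))), ∃ v, HasDerivAt V v t ∧
      v ≤ -c * V t ^ (4/5 : ℝ)) :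
    ∃ T ≥ (0:ℝ), ∀ t ≥ T, V t = 0 := by
  have hanti : ∀ a b, 0 ≤ a → a ≤ b → V b ≤ V a := by
    intro a b ha hab
    have hsub : Set.uIcc a b ⊆ Set.uIcc 0 b := by
      rw [Set.uIcc_of_le hab, Set.uIcc_of_le (ha.trans hab)]
      exact Set.Icc_subset_Icc_left ha
    have := ac_decr (c := 0) ha hab ((hac b (ha.trans hab)).mono hsub) (by
      filter_upwards [h] with t ht _
      obtain ⟨v, hv, hle⟩ := ht
      refine ⟨v, hv, hle.trans ?_⟩
      have := Real.rpow_nonneg (hV t) (4/5)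
      nlinarith)
    linarith
  have hex : ∃ T ≥ (0:ℝ), V T = 0 := by
    by_contra hcon
    push Not at hcon
    have hpos : ∀ t ≥ (0:ℝ), 0 < V t := fun t ht => lt_of_le_of_ne (hV t) (hcon t ht).symm
    set T := 5 * (V 0 ^ (1/5 : ℝ)) / c + 1 with hTdef
    have hV0 := Real.rpow_nonneg (hV 0) (1/5)
    have hT : 0 ≤ T := by positivity
    have hll : LocallyLipschitzOn (Set.Ioi 0) (fun x : ℝ => x ^ (1/5 : ℝ)) := by
      intro x hx
      have hx' : (x:ℝ) ≠ 0 := ne_of_gt hx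
      obtain ⟨K, t, ht, hl⟩ := (Real.contDiffAt_rpow_const_of_ne (n := 1) (p := 1/5) hx').exists_lipschitzOnWith
      exact ⟨K, t, mem_nhdsWithin_of_mem_nhds ht, hl⟩
    have hac' := ac_comp_ll (hac T hT) hll (fun x hx => by
      rw [Set.uIcc_of_le hT] at hx; exact hpos x hx.1)
    have := ac_decr (c := -(c/5)) le_rfl hT hac' (by
      filter_upwards [h] with t ht hm
      obtain ⟨v, hv, hle⟩ := ht
      have hp := hpos t hm.1
      refine ⟨_, hv.rpow_const (Or.inl hp.ne'), ?_⟩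
      have e : V t ^ (1/5 - 1 : ℝ) * V t ^ (4/5 : ℝ) = 1 := by
        rw [← Real.rpow_add hp]; norm_num
      have hn := Real.rpow_pos_of_pos hp (1/5 - 1)
      calc v * (1/5) * V t ^ (1/5 - 1 : ℝ)
          ≤ (-c * V t ^ (4/5 : ℝ)) * (1/5) * V t ^ (1/5 - 1 : ℝ) := by gcongr
        _ = -(c/5) * (V t ^ (1/5 - 1 : ℝ) * V t ^ (4/5 : ℝ)) := by ring
        _ = -(c/5) := by rw [e]; ring)
    have h2 := Real.rpow_nonneg (hV T) (1/5)
    have h3 : c / 5 * T = V 0 ^ (1/5 : ℝ) + c / 5 := by rw [hTdef]; field_simp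
    have h4 : V T ^ (1/5 : ℝ) - V 0 ^ (1/5 : ℝ) ≤ -(c/5) * (T - 0) := this
    nlinarith
  obtain ⟨T, hT, hVT⟩ := hex
  exact ⟨T, hT, fun t ht => le_antisymm (hVT ▸ hanti T t hT ht) (hV t)⟩

lemma hasDerivAt_sgnsq (x : ℝ) : HasDerivAt (fun x : ℝ => x * |x|) (2 * |x|) x := by
  by_cases hx : x = 0
  · subst hx
    rw [hasDerivAt_iff_tendsto_slope_zero]
    have : Filter.Tendsto (fun t : ℝ => |t|) (nhdsWithin 0 {0}ᶜ) (nhds (2 * |(0:ℝ)|)) := by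
      have h : Continuous (fun t : ℝ => |t|) := continuous_abs
      have := h.tendsto 0
      simp only [abs_zero, mul_zero] at this ⊢
      exact this.mono_left nhdsWithin_le_nhds
    refine this.congr' ?_
    filter_upwards [self_mem_nhdsWithin] with t ht
    have ht' : t ≠ 0 := ht
    simp only [zero_add, abs_zero, mul_zero, sub_zero, smul_eq_mul]
    field_simp
  · have h : HasDerivAt (fun x : ℝ => x * |x|) _ x := (hasDerivAt_id' x).mul (hasDerivAt_abs hx)
    refine h.congr_deriv ?_
    rcases lt_or_gt_of_ne hx with h0 | h0
    · simp [abs_of_neg h0, h0]; ring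
    · simp [abs_of_pos h0, h0]; ring

lemma hasDerivAt_abs43 (x : ℝ) :
    HasDerivAt (fun x : ℝ => |x| ^ (4/3 : ℝ)) (4/3 * spow x (1/3)) x := by
  have h := hasDerivAt_abs_rpow x (p := 4/3) (by norm_num)
  convert h using 1
  rw [mul_assoc]; congr 1
  unfold spow
  rcases lt_trichotomy x 0 with h0 | h0 | h0
  · have h1 : |x| ^ (1/3 : ℝ) = |x| ^ (4/3 - 2 : ℝ) * |x| := by
      rw [← Real.rpow_add_one (abs_pos.mpr h0.ne).ne']; norm_num
    rw [h1, Real.sign_of_neg h0, abs_of_neg h0]; ring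
  · subst h0; simp
  · have h1 : |x| ^ (1/3 : ℝ) = |x| ^ (4/3 - 2 : ℝ) * |x| := by
      rw [← Real.rpow_add_one (abs_pos.mpr h0.ne').ne']; norm_num
    rw [h1, Real.sign_of_pos h0, abs_of_pos h0]; ring

/-- weight-one coordinates of the state -/
noncomputable def coords (x₁ x₂ e₁ e₂ w : ℝ) : Fin 5 → ℝ :=
  ![spow x₁ (1/3), spow x₂ (1/2), spow e₁ (1/3), spow e₂ (1/2), w]

lemma coordsU (x₁ x₂ e₁ e₂ w : ℝ) : sU (coords x₁ x₂ e₁ e₂ w) =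
    3/4 * |e₁| ^ (4/3 : ℝ) + w * e₁ + 1/4 * ((w * w) * (w * w))
      + 1/2 * ((e₂ + w * |w|) * (e₂ + w * |w|)) := by
  have h : sU (coords x₁ x₂ e₁ e₂ w) = 3/4 * spow e₁ (1/3) ^ 4 + w * spow e₁ (1/3) ^ 3 + w ^ 4 / 4
    + (spow e₂ (1/2) * |spow e₂ (1/2)| + w * |w|) ^ 2 / 2 := rfl
  rw [h, spow_third_cube, spow_half_sq, abs_four_thirds]; ring

lemma coordsH (x₁ x₂ e₁ e₂ w : ℝ) : sH (coords x₁ x₂ e₁ e₂ w) =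
    3/4 * |x₁| ^ (4/3 : ℝ) - 2 * (w * x₁) + 4 * ((w * w) * (w * w)) + 1/2 * (x₂ * x₂) := by
  have h : sH (coords x₁ x₂ e₁ e₂ w) = 3/4 * spow x₁ (1/3) ^ 4 - 2 * w * spow x₁ (1/3) ^ 3
    + 4 * w ^ 4 + (spow x₂ (1/2) * |spow x₂ (1/2)|) ^ 2 / 2 := rfl
  rw [h, spow_third_cube, spow_half_sq, abs_four_thirds]; ring

lemma coordsV (A B C D μ x₁ x₂ e₁ e₂ w : ℝ) : sV A B C D μ (coords x₁ x₂ e₁ e₂ w) =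
    A * (3/4 * |e₁| ^ (4/3 : ℝ) + w * e₁ + 1/4 * ((w * w) * (w * w))
      + 1/2 * ((e₂ + w * |w|) * (e₂ + w * |w|))) ^ (5/4 : ℝ)
    - B * ((e₁ + w * w * w) * (e₂ + w * |w|))
    + C * (3/4 * |x₁| ^ (4/3 : ℝ) - 2 * (w * x₁) + 4 * ((w * w) * (w * w))
      + 1/2 * (x₂ * x₂)) ^ (5/4 : ℝ)
    + D * ((x₁ - 8 * (w * w * w)) * x₂) + μ * ((w * w * w) * (w * |w|)) := by
  have h1 : sc1 (coords x₁ x₂ e₁ e₂ w) = -((spow e₁ (1/3) ^ 3 + w ^ 3) *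
    (spow e₂ (1/2) * |spow e₂ (1/2)| + w * |w|)) := rfl
  have h2 : sc2 (coords x₁ x₂ e₁ e₂ w) = (spow x₁ (1/3) ^ 3 - 8 * w ^ 3) *
    (spow x₂ (1/2) * |spow x₂ (1/2)|) := rfl
  have h4 : coords x₁ x₂ e₁ e₂ w 4 = w := rfl
  unfold sV
  rw [coordsU, coordsH, h1, h2, h4, spow_third_cube, spow_third_cube, spow_half_sq, spow_half_sq]
  ring

lemma coords_zero {x₁ x₂ e₁ e₂ w : ℝ} (h : coords x₁ x₂ e₁ e₂ w = 0) :
    x₁ = 0 ∧ x₂ = 0 ∧ e₁ = 0 ∧ e₂ = 0 ∧ w = 0 := by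
  have h0 : spow x₁ (1/3) = 0 := congrFun h 0
  have h1 : spow x₂ (1/2) = 0 := congrFun h 1
  have h2 : spow e₁ (1/3) = 0 := congrFun h 2
  have h3 : spow e₂ (1/2) = 0 := congrFun h 3
  have h4 : w = 0 := congrFun h 4
  refine ⟨?_, ?_, ?_, ?_, h4⟩
  · rw [← spow_third_cube x₁, h0]; norm_num
  · rw [← spow_half_sq x₂, h1]; norm_num
  · rw [← spow_third_cube e₁, h2]; norm_num
  · rw [← spow_half_sq e₂, h3]; norm_num

lemma V_deriv (A B C D ε : ℝ) (hε : 0 < ε) {x₁ x₂ e₁ e₂ w : ℝ → ℝ} {t ω : ℝ}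
    (h1 : HasDerivAt x₁ (x₂ t) t)
    (h2 : HasDerivAt x₂ (-spow (x₁ t) (1/3) - spow (x₂ t + e₂ t) (1/2) + w t) t)
    (h3 : HasDerivAt e₁ (-spow (e₁ t) (2/3) + e₂ t) t)
    (h4 : HasDerivAt e₂ (-spow (e₁ t) (1/3) - w t) t)
    (h5 : HasDerivAt w ω t) (hω : |ω| ≤ 3/2 * ε)
    (hs : 0 < x₁ t * w t → w t * ω ≤ -(ε/2) * |w t|) :
    ∃ v, HasDerivAt (fun s => sV A B C D (1/ε) (coords (x₁ s) (x₂ s) (e₁ s) (e₂ s) (w s))) v t ∧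
      v ≤ sG A B C D ε (coords (x₁ t) (x₂ t) (e₁ t) (e₂ t) (w t)) := by
  have dww : HasDerivAt (fun s => w s * |w s|) (2 * |w t| * ω) t :=
    (hasDerivAt_sgnsq (w t)).comp t h5
  have dE : HasDerivAt (fun s => |e₁ s| ^ (4/3 : ℝ)) _ t := (hasDerivAt_abs43 (e₁ t)).comp t h3
  have dX : HasDerivAt (fun s => |x₁ s| ^ (4/3 : ℝ)) _ t := (hasDerivAt_abs43 (x₁ t)).comp t h1
  have dw2 : HasDerivAt (fun s => w s * w s) _ t := h5.mul h5
  have dw3 : HasDerivAt (fun s => w s * w s * w s) _ t := dw2.mul h5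
  have dw4 : HasDerivAt (fun s => (w s * w s) * (w s * w s)) _ t := dw2.mul dw2
  have dε2 : HasDerivAt (fun s => e₂ s + w s * |w s|) _ t := h4.add dww
  have dU : HasDerivAt (fun s => 3/4 * |e₁ s| ^ (4/3 : ℝ) + w s * e₁ s
      + 1/4 * ((w s * w s) * (w s * w s))
      + 1/2 * ((e₂ s + w s * |w s|) * (e₂ s + w s * |w s|))) _ t :=
    (((dE.const_mul (3/4)).add (h5.mul h3)).add (dw4.const_mul (1/4))).add
      ((dε2.mul dε2).const_mul (1/2))
  have dH : HasDerivAt (fun s => 3/4 * |x₁ s| ^ (4/3 : ℝ) - 2 * (w s * x₁ s)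
      + 4 * ((w s * w s) * (w s * w s)) + 1/2 * (x₂ s * x₂ s)) _ t :=
    (((dX.const_mul (3/4)).sub ((h5.mul h1).const_mul 2)).add (dw4.const_mul 4)).add
      ((h2.mul h2).const_mul (1/2))
  have dU' := dU.rpow_const (p := 5/4) (Or.inr (by norm_num))
  have dH' := dH.rpow_const (p := 5/4) (Or.inr (by norm_num))
  have dA : HasDerivAt (fun s => e₁ s + w s * w s * w s) _ t := h3.add dw3
  have dB : HasDerivAt (fun s => x₁ s - 8 * (w s * w s * w s)) _ t :=
    h1.sub (dw3.const_mul 8)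
  have d1 : HasDerivAt (fun s => (e₁ s + w s * w s * w s) * (e₂ s + w s * |w s|)) _ t :=
    dA.mul dε2
  have d2 : HasDerivAt (fun s => (x₁ s - 8 * (w s * w s * w s)) * x₂ s) _ t :=
    dB.mul h2
  have d5 : HasDerivAt (fun s => (w s * w s * w s) * (w s * |w s|)) _ t := dw3.mul dww
  have dV := ((((dU'.const_mul A).sub (d1.const_mul B)).add (dH'.const_mul C)).add
    (d2.const_mul D)).add (d5.const_mul (1/ε))
  set y := coords (x₁ t) (x₂ t) (e₁ t) (e₂ t) (w t) with hy
  set hh := A * sh1 y + B * sh2 y + C * sh3 y + D * sh4 y with hhdef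
  have key : HasDerivAt (fun s => sV A B C D (1/ε) (coords (x₁ s) (x₂ s) (e₁ s) (e₂ s) (w s)))
      (A * sf1 y + B * sf2 y + C * sf3 y + D * sf4 y + hh * ω
        + 1/ε * (5 * w t ^ 3 * |w t| * ω)) t := by
    simp_rw [coordsV]
    refine dV.congr_deriv ?_
    have y0 : y 0 = spow (x₁ t) (1/3) := rfl
    have y1 : y 1 = spow (x₂ t) (1/2) := rfl
    have y2 : y 2 = spow (e₁ t) (1/3) := rfl
    have y3 : y 3 = spow (e₂ t) (1/2) := rfl
    have y4 : y 4 = w t := rfl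
    have hS : sS y = spow (x₂ t + e₂ t) (1/2) := by
      unfold sS; rw [y1, y3, spow_half_sq, spow_half_sq]
    have hU := coordsU (x₁ t) (x₂ t) (e₁ t) (e₂ t) (w t)
    have hH := coordsH (x₁ t) (x₂ t) (e₁ t) (e₂ t) (w t)
    rw [← hy] at hU hH
    rw [← hU, ← hH, hhdef]
    unfold sf1 sf2 sf3 sf4 sh1 sh2 sh3 sh4
    rw [hS, y0, y1, y2, y3, y4, spow_third_cube, spow_third_cube, spow_half_sq, spow_half_sq,
      spow_two_thirds, show (5/4 - 1 : ℝ) = 1/4 by norm_num]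
    have ww : |w t| ^ 2 = w t ^ 2 := sq_abs _
    ring_nf
  refine ⟨_, key, ?_⟩
  unfold sG
  have b1 : hh * ω ≤ 3/2 * ε * |hh| := by
    calc hh * ω ≤ |hh * ω| := le_abs_self _
      _ = |hh| * |ω| := abs_mul _ _
      _ ≤ |hh| * (3/2 * ε) := by gcongr
      _ = _ := by ring
  have b2 : 1/ε * (5 * w t ^ 3 * |w t| * ω) ≤ sfw y := by
    have e : sfw y = -(5/2) * w t ^ 4 + 5/4 * (|w t| * |x₁ t - 8 * w t ^ 3|) := by
      have : sfw y = -(5/2) * w t ^ 4 + 5/4 * (|w t| * |spow (x₁ t) (1/3) ^ 3 - 8 * w t ^ 3|) := rfl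
      rw [this, spow_third_cube]
    rw [e, one_div, inv_mul_le_iff₀ hε]
    have ww : |w t| ^ 2 = w t ^ 2 := sq_abs _
    have w4 : |w t| ^ 4 = w t ^ 4 := by
      rw [show |w t| ^ 4 = (|w t| ^ 2) ^ 2 by ring, ww]; ring
    by_cases hp : 0 < x₁ t * w t
    · have a1 := mul_le_mul_of_nonneg_left (hs hp) (show 0 ≤ 5 * w t ^ 2 * |w t| by positivity)
      have a2 : 5 * w t ^ 2 * |w t| * (-(ε/2) * |w t|) = ε * (-(5/2) * w t ^ 4) := by
        calc _ = -(5/2) * ε * w t ^ 2 * |w t| ^ 2 := by ring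
          _ = _ := by rw [ww]; ring
      have a3 : 0 ≤ ε * (5/4 * (|w t| * |x₁ t - 8 * w t ^ 3|)) := by positivity
      nlinarith
    · push Not at hp
      have a1 : 5 * w t ^ 3 * |w t| * ω ≤ 15/2 * ε * w t ^ 4 := by
        calc 5 * w t ^ 3 * |w t| * ω ≤ |5 * w t ^ 3 * |w t| * ω| := le_abs_self _
          _ = 5 * |w t| ^ 4 * |ω| := by
            rw [abs_mul, abs_mul, abs_mul, abs_pow, abs_abs, abs_of_pos (by norm_num : (0:ℝ) < 5)]
            ring
          _ ≤ 5 * |w t| ^ 4 * (3/2 * ε) := by gcongr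
          _ = _ := by rw [w4]; ring
      have a2 : 8 * w t ^ 4 ≤ |w t| * |x₁ t - 8 * w t ^ 3| := by
        rw [← abs_mul]
        have : -(w t * (x₁ t - 8 * w t ^ 3)) ≤ |w t * (x₁ t - 8 * w t ^ 3)| := neg_le_abs _
        nlinarith
      have a3 := mul_le_mul_of_nonneg_left a2 hε.le
      nlinarith
  linarith

lemma core : ∃ ε > (0:ℝ), ∀ x₁ x₂ e₁ e₂ w : ℝ → ℝ,
    (∀ t ≥ (0:ℝ), HasDerivAt x₁ (x₂ t) t) →
    (∀ t ≥ (0:ℝ), HasDerivAt x₂ (-spow (x₁ t) (1/3) - spow (x₂ t + e₂ t) (1/2) + w t) t) →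
    (∀ t ≥ (0:ℝ), HasDerivAt e₁ (-spow (e₁ t) (2/3) + e₂ t) t) →
    (∀ t ≥ (0:ℝ), HasDerivAt e₂ (-spow (e₁ t) (1/3) - w t) t) →
    LocallyLipschitz w →
    (∀ᵐ t ∂(volume.restrict (Set.Ici (0:ℝ))), ∃ ω, HasDerivAt w ω t ∧ |ω| ≤ 3/2 * ε ∧
      (0 < x₁ t * w t → w t * ω ≤ -(ε/2) * |w t|)) →
    ∃ T ≥ (0:ℝ), ∀ t ≥ T, x₁ t = 0 ∧ x₂ t = 0 ∧ e₁ t = 0 ∧ e₂ t = 0 ∧ w t = 0 := by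
  obtain ⟨A, B, C, D, ε, c, hε, hc, hpos, hnn, hG⟩ := static_main
  refine ⟨ε, hε, fun x₁ x₂ e₁ e₂ w h1 h2 h3 h4 hw hae => ?_⟩
  have c1 : ContinuousOn x₁ (Set.Ici 0) := fun t ht => (h1 t ht).continuousAt.continuousWithinAt
  have c2 : ContinuousOn x₂ (Set.Ici 0) := fun t ht => (h2 t ht).continuousAt.continuousWithinAt
  have c3 : ContinuousOn e₁ (Set.Ici 0) := fun t ht => (h3 t ht).continuousAt.continuousWithinAt
  have c4 : ContinuousOn e₂ (Set.Ici 0) := fun t ht => (h4 t ht).continuousAt.continuousWithinAt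
  have c5 : ContinuousOn w (Set.Ici 0) := hw.continuous.continuousOn
  have s13 : Continuous (fun x => spow x (1/3)) := continuous_spow (by norm_num)
  have s12 : Continuous (fun x => spow x (1/2)) := continuous_spow (by norm_num)
  have s23 : Continuous (fun x => spow x (2/3)) := continuous_spow (by norm_num)
  have d1 : ContinuousOn (fun t => spow (x₁ t) (1/3)) (Set.Ici 0) := s13.comp_continuousOn c1
  have d2 : ContinuousOn (fun t => spow (x₂ t + e₂ t) (1/2)) (Set.Ici 0) :=
    s12.comp_continuousOn (c2.add c4)
  have d3 : ContinuousOn (fun t => spow (e₁ t) (2/3)) (Set.Ici 0) := s23.comp_continuousOn c3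
  have d4 : ContinuousOn (fun t => spow (e₁ t) (1/3)) (Set.Ici 0) := s13.comp_continuousOn c3
  obtain ⟨T, hT, hTz⟩ := finite_time
    (V := fun s => sV A B C D (1/ε) (coords (x₁ s) (x₂ s) (e₁ s) (e₂ s) (w s))) hc
    (fun t => hnn _) (by
      intro T hT
      have a1 := ac_of_deriv h1 c2 hT
      have a2 := ac_of_deriv h2 ((d1.neg.sub d2).add c5) hT
      have a3 := ac_of_deriv h3 (d3.neg.add c4) hT
      have a4 := ac_of_deriv h4 (d4.neg.sub c5) hT
      have a5 : AbsolutelyContinuousOnInterval w 0 T := by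
        obtain ⟨K, hK⟩ := (hw.locallyLipschitzOn (s := Set.uIcc 0 T)).exists_lipschitzOnWith_of_compact
          isCompact_uIcc
        exact hK.absolutelyContinuousOnInterval
      have a6 := ac_mul a5 (ac_abs a5)
      have w2 := ac_mul a5 a5
      have w3 := ac_mul w2 a5
      have w4 := ac_mul w2 w2
      have aE := ac_rpow (p := 4/3) (by norm_num) (ac_abs a3)
      have aX := ac_rpow (p := 4/3) (by norm_num) (ac_abs a1)
      have aε := ac_add a4 a6
      have aU := ac_rpow (p := 5/4) (by norm_num)
        (ac_add (ac_add (ac_add (ac_cmul (3/4) aE) (ac_mul a5 a3)) (ac_cmul (1/4) w4))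
          (ac_cmul (1/2) (ac_mul aε aε)))
      have aH := ac_rpow (p := 5/4) (by norm_num)
        (ac_add (ac_add (ac_sub (ac_cmul (3/4) aX) (ac_cmul 2 (ac_mul a5 a1))) (ac_cmul 4 w4))
          (ac_cmul (1/2) (ac_mul a2 a2)))
      simp_rw [coordsV]
      exact ac_add (ac_add (ac_add (ac_sub (ac_cmul A aU)
        (ac_cmul B (ac_mul (ac_add a3 w3) aε))) (ac_cmul C aH))
        (ac_cmul D (ac_mul (ac_sub a1 (ac_cmul 8 w3)) a2)))
        (ac_cmul (1/ε) (ac_mul w3 a6)))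
    (by
      filter_upwards [hae, ae_restrict_mem measurableSet_Ici] with t ht ht0
      obtain ⟨ω, hω, hb, hs⟩ := ht
      obtain ⟨v, hv, hle⟩ := V_deriv A B C D ε hε (h1 t ht0) (h2 t ht0) (h3 t ht0) (h4 t ht0)
        hω hb hs
      exact ⟨v, hv, hle.trans (hG _)⟩)
  refine ⟨T, hT, fun t ht => ?_⟩
  apply coords_zero
  by_contra hne
  exact (hpos _ hne).ne' (hTz t ht)

/-- Theorem 2 (output feedback with observer and discontinuous integral controller):
for every Lipschitz bound `L > 0` there are gains `k₁, k₂, k₃ > 0`, `k₄ ≥ 0` and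
observer gains `l₁, l₂ > 0` such that every Filippov solution of the closed loop
`ẋ₁ = x₂`, `ẋ₂ = −k₁⌈x₁⌋^{1/3} − k₂⌈x₂+e₂⌋^{1/2} + z + ρ(t)`,
`ė₁ = −l₁⌈e₁⌋^{2/3} + e₂`, `ė₂ = −l₂⌈e₁⌋^{1/3} − (z + ρ(t))`,
`ż = −k₃⌈x₁ + k₄⌈x₂+e₂⌋^{3/2}⌋⁰`
reaches `x₁ = x₂ = e₁ = e₂ = z + ρ = 0` in finite time. -/
theorem discontinuous_integral_controller_output_feedback :
    ∀ L > (0 : ℝ),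
      ∃ k₁ > (0 : ℝ), ∃ k₂ > (0 : ℝ), ∃ k₃ > (0 : ℝ), ∃ k₄ ≥ (0 : ℝ),
        ∃ l₁ > (0 : ℝ), ∃ l₂ > (0 : ℝ),
        ∀ ρ : ℝ → ℝ, LipschitzWith L.toNNReal ρ →
        ∀ x₁ x₂ e₁ e₂ z : ℝ → ℝ,
          (∀ t ≥ (0 : ℝ), HasDerivAt x₁ (x₂ t) t) →
          (∀ t ≥ (0 : ℝ), HasDerivAt x₂
            (-k₁ * spow (x₁ t) (1/3) - k₂ * spow (x₂ t + e₂ t) (1/2) + z t + ρ t) t) →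
          (∀ t ≥ (0 : ℝ), HasDerivAt e₁ (-l₁ * spow (e₁ t) (2/3) + e₂ t) t) →
          (∀ t ≥ (0 : ℝ), HasDerivAt e₂ (-l₂ * spow (e₁ t) (1/3) - (z t + ρ t)) t) →
          LocallyLipschitz z →
          (∀ᵐ t ∂(volume.restrict (Set.Ici (0 : ℝ))),
            ∃ d : ℝ, HasDerivAt z d t ∧
              ((x₁ t + k₄ * spow (x₂ t + e₂ t) (3/2) ≠ 0 →
                 d = -k₃ * Real.sign (x₁ t + k₄ * spow (x₂ t + e₂ t) (3/2))) ∧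
               (x₁ t + k₄ * spow (x₂ t + e₂ t) (3/2) = 0 → |d| ≤ k₃))) →
          ∃ T ≥ (0 : ℝ), ∀ t ≥ T,
            x₁ t = 0 ∧ x₂ t = 0 ∧ e₁ t = 0 ∧ e₂ t = 0 ∧ z t + ρ t = 0 := by
  intro L hL
  obtain ⟨ε, hε, hcore⟩ := core
  obtain ⟨r, hr, hr6⟩ : ∃ r : ℝ, 0 < r ∧ r ^ 6 = 2 * L / ε := by
    refine ⟨(2 * L / ε) ^ (1/6 : ℝ), by positivity, ?_⟩
    rw [← Real.rpow_natCast, ← Real.rpow_mul (by positivity)]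
    norm_num
  have hc : (0:ℝ) < r ^ 6 := by positivity
  have p13 : (r ^ 6) ^ (1/3 : ℝ) = r ^ 2 := by
    rw [← Real.rpow_natCast r 6, ← Real.rpow_mul hr.le, ← Real.rpow_natCast r 2]; norm_num
  have p12 : (r ^ 6) ^ (1/2 : ℝ) = r ^ 3 := by
    rw [← Real.rpow_natCast r 6, ← Real.rpow_mul hr.le, ← Real.rpow_natCast r 3]; norm_num
  have p23 : (r ^ 6) ^ (2/3 : ℝ) = r ^ 4 := by
    rw [← Real.rpow_natCast r 6, ← Real.rpow_mul hr.le, ← Real.rpow_natCast r 4]; norm_num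
  have sc : ∀ x p : ℝ, spow x p = (r ^ 6) ^ p * spow (x / r ^ 6) p := by
    intro x p
    rw [← spow_scale hc, mul_div_cancel₀ _ hc.ne']
  refine ⟨r ^ 4, by positivity, r ^ 3, by positivity, 2 * L, by positivity, 0, le_rfl,
    r ^ 2, by positivity, r ^ 4, by positivity, ?_⟩
  intro ρ hρ x₁ x₂ e₁ e₂ z h1 h2 h3 h4 hz hae
  have hW : LocallyLipschitz (fun t => (z t + ρ t) / r ^ 6) := by
    have h := (hz.add hρ.locallyLipschitz)
    have h' := (lipschitzWith_smul ((r ^ 6)⁻¹)).locallyLipschitz.comp h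
    have e : (fun t => (z t + ρ t) / r ^ 6)
        = (fun x : ℝ => (r ^ 6)⁻¹ • x) ∘ (fun t => z t + ρ t) := by
      funext t
      simp only [Function.comp_apply, smul_eq_mul, div_eq_inv_mul]
    rw [e]
    exact h'
  obtain ⟨T, hT, hz0⟩ := hcore (fun t => x₁ t / r ^ 6) (fun t => x₂ t / r ^ 6)
    (fun t => e₁ t / r ^ 6) (fun t => e₂ t / r ^ 6) (fun t => (z t + ρ t) / r ^ 6)
    (fun t ht => (h1 t ht).div_const _)
    (fun t ht => by
      refine ((h2 t ht).div_const (r ^ 6)).congr_deriv ?_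
      rw [sc (x₁ t), sc (x₂ t + e₂ t), p13, p12, add_div (x₂ t)]
      field_simp
      ring)
    (fun t ht => by
      refine ((h3 t ht).div_const (r ^ 6)).congr_deriv ?_
      rw [sc (e₁ t), p23]
      field_simp)
    (fun t ht => by
      refine ((h4 t ht).div_const (r ^ 6)).congr_deriv ?_
      rw [sc (e₁ t), p13]
      field_simp)
    hW
    (by
      have hd := ae_restrict_of_ae (s := Set.Ici (0:ℝ)) hρ.ae_differentiableAt_real
      filter_upwards [hae, hd] with t ⟨d, hd, hne, heq⟩ hρd
      have hb : |deriv ρ t| ≤ L := by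
        have := norm_deriv_le_of_lipschitz (x₀ := t) hρ
        rwa [Real.coe_toNNReal _ hL.le, Real.norm_eq_abs] at this
      simp only [zero_mul, add_zero] at hne heq
      have hdb : |d| ≤ 2 * L := by
        by_cases hx : x₁ t = 0
        · exact heq hx
        · rw [hne hx]
          rcases lt_or_gt_of_ne hx with h0 | h0
          · rw [Real.sign_of_neg h0]; simp [abs_of_pos hL]
          · rw [Real.sign_of_pos h0]; simp [abs_of_pos hL]
      have hLε : L = ε / 2 * r ^ 6 := by rw [hr6]; field_simp
      refine ⟨(d + deriv ρ t) / r ^ 6, (hd.add hρd.hasDerivAt).div_const _, ?_, ?_⟩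
      · rw [abs_div, abs_of_pos hc, div_le_iff₀ hc]
        have := abs_add_le d (deriv ρ t)
        nlinarith
      · intro hp
        have hp' : 0 < x₁ t * (z t + ρ t) := by
          have : x₁ t / r ^ 6 * ((z t + ρ t) / r ^ 6) * (r ^ 6 * r ^ 6) = x₁ t * (z t + ρ t) := by
            field_simp
          rw [← this]; positivity
        have hx : x₁ t ≠ 0 := by rintro h; simp [h] at hp'
        have key : (z t + ρ t) * (d + deriv ρ t) ≤ -L * |z t + ρ t| := by
          rw [hne hx]
          obtain ⟨b1, b2⟩ := abs_le.mp hb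
          rcases lt_or_gt_of_ne hx with h0 | h0
          · have hw : z t + ρ t < 0 := by
              by_contra hcon; push Not at hcon; nlinarith
            rw [Real.sign_of_neg h0, abs_of_neg hw]; nlinarith
          · have hw : 0 < z t + ρ t := by
              by_contra hcon; push Not at hcon; nlinarith
            rw [Real.sign_of_pos h0, abs_of_pos hw]; nlinarith
        rw [abs_div, abs_of_pos hc, div_mul_div_comm, div_le_iff₀ (by positivity)]
        calc _ ≤ _ := key
          _ = _ := by
            rw [hLε]; field_simp)
  refine ⟨T, hT, fun t ht => ?_⟩
  have := hz0 t ht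
  simpa [div_eq_zero_iff, hc.ne', hr.ne'] using this
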